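/- arXiv:0911.4219 — 4 statements merged into one kernel-verified Lean document; each statement's English description precedes it below -/
import Mathlib

section
/- For every x ∈ ℝ and b > 0, the mean F_β(x; b) of the probability density f_β(·; x, b) converges, as β → ∞, to the soft-thresholding value η(x; b) = sign(x)·(|x| − b)₊. -/
open MeasureTheory Filter

/-- Soft thresholding: η(x; b) = sign(x) · max(|x| − b, 0). -/
noncomputable def softThresh (x b : ℝ) : ℝ := Real.sign x * max (|x| - b) 0

/-- Unnormalized density exp(−β|s| − (β/(2b))(s − x)²). -/
noncomputable def ampWeight (β x b s : ℝ) : ℝ :=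
  Real.exp (-β * |s| - (β / (2 * b)) * (s - x) ^ 2)

/-- Normalizing constant z_β(x, b). -/
noncomputable def ampZ (β x b : ℝ) : ℝ := ∫ s : ℝ, ampWeight β x b s

/-- Mean F_β(x; b) of the probability density f_β(·; x, b). -/
noncomputable def ampF (β x b : ℝ) : ℝ := (∫ s : ℝ, s * ampWeight β x b s) / ampZ β x b

lemma abs_softThresh_sub_le (x b : ℝ) (hb : 0 < b) : |softThresh x b - x| ≤ b := by
  unfold softThresh
  rcases lt_trichotomy x 0 with hx | rfl | hx
  · rw [Real.sign_of_neg hx, abs_of_neg hx, abs_le]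
    rcases max_cases (-x - b) 0 with h | h <;> constructor <;> linarith
  · simpa using hb.le
  · rw [Real.sign_of_pos hx, abs_of_pos hx, abs_le]
    rcases max_cases (x - b) 0 with h | h <;> constructor <;> linarith

/-- `(x - η(x; b)) / b` is a subgradient of the absolute value at `η(x; b)`. -/
lemma softThresh_subgradient (x b s : ℝ) (hb : 0 < b) :
    b * |softThresh x b| + (s - softThresh x b) * (x - softThresh x b) ≤ b * |s| := by
  have h1 := mul_le_mul_of_nonneg_left (le_abs_self s) hb.le
  have h2 := mul_le_mul_of_nonneg_left (neg_abs_le s) hb.le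
  have h3 : |x| ≤ b → s * x ≤ b * |s| := fun h => by
    calc s * x ≤ |s * x| := le_abs_self _
      _ = |x| * |s| := by rw [abs_mul, mul_comm]
      _ ≤ b * |s| := by gcongr
  unfold softThresh
  rcases le_or_gt |x| b with h | h
  · rw [max_eq_right (by linarith)]
    simpa using h3 h
  · rw [max_eq_left (by linarith)]
    rcases lt_trichotomy x 0 with hx | rfl | hx
    · rw [abs_of_neg hx] at h
      rw [Real.sign_of_neg hx, abs_of_neg hx, abs_of_neg (by linarith : -1 * (-x - b) < 0)]
      nlinarith
    · simp at h; linarith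
    · rw [abs_of_pos hx] at h
      rw [Real.sign_of_pos hx, abs_of_pos hx, abs_of_pos (by linarith : 0 < 1 * (x - b))]
      nlinarith

/-- Excess at `s` of the energy `|s| + (s - x)² / (2b)` over its value at `η(x; b)`. -/
noncomputable def excessEnergy (x b s : ℝ) : ℝ :=
  |s| - |softThresh x b| + ((s - x) ^ 2 - (softThresh x b - x) ^ 2) / (2 * b)

lemma continuous_excessEnergy (x b : ℝ) : Continuous (excessEnergy x b) := by
  unfold excessEnergy; fun_prop

lemma sq_div_le_excessEnergy (x b s : ℝ) (hb : 0 < b) :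
    (s - softThresh x b) ^ 2 / (2 * b) ≤ excessEnergy x b s := by
  have h := softThresh_subgradient x b s hb
  have : excessEnergy x b s - (s - softThresh x b) ^ 2 / (2 * b) =
      (b * |s| - (b * |softThresh x b| + (s - softThresh x b) * (x - softThresh x b))) / b := by
    unfold excessEnergy; field_simp; ring
  have h' := div_nonneg (sub_nonneg.2 h) hb.le
  linarith

lemma excessEnergy_le (x b s : ℝ) (hb : 0 < b) :
    excessEnergy x b s ≤ 2 * |s - softThresh x b| + (s - softThresh x b) ^ 2 / (2 * b) := by
  have h1 := abs_sub_abs_le_abs_sub s (softThresh x b)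
  have h2 : (s - softThresh x b) * (softThresh x b - x) / b ≤ |s - softThresh x b| := by
    rw [div_le_iff₀ hb]
    refine (le_abs_self _).trans ?_
    rw [abs_mul]
    gcongr
    exact abs_softThresh_sub_le x b hb
  have : excessEnergy x b s = |s| - |softThresh x b| +
      (s - softThresh x b) * (softThresh x b - x) / b + (s - softThresh x b) ^ 2 / (2 * b) := by
    unfold excessEnergy; field_simp; ring
  linarith

lemma ampWeight_eq (β x b s : ℝ) :
    ampWeight β x b s = ampWeight β x b (softThresh x b) * Real.exp (-β * excessEnergy x b s) := by
  unfold ampWeight excessEnergy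
  rw [← Real.exp_add]
  congr 1
  ring

lemma exp_neg_excessEnergy_le (β x b s : ℝ) (hβ : 0 ≤ β) (hb : 0 < b) :
    Real.exp (-β * excessEnergy x b s) ≤
      Real.exp (-(β / (2 * b)) * (s - softThresh x b) ^ 2) := by
  have := mul_le_mul_of_nonneg_left (sq_div_le_excessEnergy x b s hb) hβ
  apply Real.exp_le_exp.2
  calc -β * excessEnergy x b s ≤ -(β * ((s - softThresh x b) ^ 2 / (2 * b))) := by linarith
    _ = _ := by ring

lemma integrable_exp_neg_excessEnergy (β x b : ℝ) (hβ : 0 < β) (hb : 0 < b) :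
    Integrable fun s => Real.exp (-β * excessEnergy x b s) := by
  have hc := continuous_excessEnergy x b
  refine ((integrable_exp_neg_mul_sq (b := β / (2 * b)) (by positivity)).comp_sub_right
    (softThresh x b)).mono' (by fun_prop) (.of_forall fun s => ?_)
  rw [Real.norm_of_nonneg (Real.exp_pos _).le]
  exact exp_neg_excessEnergy_le β x b s hβ.le hb

lemma integrable_abs_sub_mul_gaussian (c m : ℝ) (hc : 0 < c) :
    Integrable fun s : ℝ => |s - m| * Real.exp (-c * (s - m) ^ 2) := by
  refine ((integrable_mul_exp_neg_mul_sq hc).comp_sub_right m).norm.congr (.of_forall fun s => ?_)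
  simp

lemma integrable_sub_mul_exp_neg_excessEnergy (β x b : ℝ) (hβ : 0 < β) (hb : 0 < b) :
    Integrable fun s => (s - softThresh x b) * Real.exp (-β * excessEnergy x b s) := by
  have hc := continuous_excessEnergy x b
  refine (integrable_abs_sub_mul_gaussian (β / (2 * b)) (softThresh x b) (by positivity)).mono'
    (by fun_prop) (.of_forall fun s => ?_)
  rw [norm_mul, Real.norm_eq_abs, Real.norm_of_nonneg (Real.exp_pos _).le]
  exact mul_le_mul_of_nonneg_left (exp_neg_excessEnergy_le β x b s hβ.le hb) (abs_nonneg _)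

lemma le_integral_exp_neg_excessEnergy (β x b : ℝ) (hβ : 1 ≤ β) (hb : 0 < b) :
    2 / β * Real.exp (-(2 + 1 / (2 * b))) ≤ ∫ s, Real.exp (-β * excessEnergy x b s) := by
  have hβ0 : 0 < β := by linarith
  set m := softThresh x b with hm
  have hexp := integrable_exp_neg_excessEnergy β x b hβ0 hb
  calc 2 / β * Real.exp (-(2 + 1 / (2 * b)))
      = ∫ s in Set.Icc (m - 1 / β) (m + 1 / β), Real.exp (-(2 + 1 / (2 * b))) := by
        rw [setIntegral_const, Real.volume_real_Icc_of_le (by linarith [one_div_pos.2 hβ0]),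
          smul_eq_mul]
        ring
    _ ≤ ∫ s in Set.Icc (m - 1 / β) (m + 1 / β), Real.exp (-β * excessEnergy x b s) := by
        refine setIntegral_mono_on (by simp) hexp.integrableOn measurableSet_Icc fun s hs => ?_
        have hs' : |s - m| ≤ 1 / β := by
          rw [abs_le]; constructor <;> linarith [hs.1, hs.2]
        have h1 : β * |s - m| ≤ 1 := by
          rw [le_div_iff₀ hβ0] at hs'; linarith
        have h2 : β * (s - m) ^ 2 ≤ 1 := by
          rw [← sq_abs]
          nlinarith [abs_nonneg (s - m)]
        have h3 : β * ((s - m) ^ 2 / (2 * b)) ≤ 1 / (2 * b) := by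
          rw [← mul_div_assoc]; gcongr
        have h4 := mul_le_mul_of_nonneg_left (excessEnergy_le x b s hb) hβ0.le
        apply Real.exp_le_exp.2
        rw [← hm] at h4
        linarith
    _ ≤ _ := setIntegral_le_integral hexp (.of_forall fun s => (Real.exp_pos _).le)

lemma ampF_sub_softThresh (β x b : ℝ) (hβ : 0 < β) (hb : 0 < b) :
    ampF β x b - softThresh x b =
      (∫ s, (s - softThresh x b) * Real.exp (-β * excessEnergy x b s)) /
        ∫ s, Real.exp (-β * excessEnergy x b s) := by
  have hexp := integrable_exp_neg_excessEnergy β x b hβ hb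
  have hmul := integrable_sub_mul_exp_neg_excessEnergy β x b hβ hb
  have hpos : 0 < ∫ s, Real.exp (-β * excessEnergy x b s) := integral_exp_pos hexp
  have hw : ampWeight β x b (softThresh x b) ≠ 0 := (Real.exp_pos _).ne'
  have hZ : ampZ β x b = ampWeight β x b (softThresh x b) *
      ∫ s, Real.exp (-β * excessEnergy x b s) := by
    rw [ampZ, ← integral_const_mul]
    exact integral_congr_ae (.of_forall fun s => ampWeight_eq β x b s)
  have hN : ∫ s, s * ampWeight β x b s = ampWeight β x b (softThresh x b) *
      ((∫ s, (s - softThresh x b) * Real.exp (-β * excessEnergy x b s)) +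
        softThresh x b * ∫ s, Real.exp (-β * excessEnergy x b s)) := by
    rw [← integral_const_mul (softThresh x b), ← integral_add hmul (hexp.const_mul _),
      ← integral_const_mul]
    refine integral_congr_ae (.of_forall fun s => ?_)
    simp only
    rw [ampWeight_eq β x b s]
    ring
  rw [ampF, hZ, hN, mul_div_mul_left _ _ hw, add_div, mul_div_cancel_right₀ _ hpos.ne',
    add_sub_cancel_right]

lemma abs_sub_mul_exp_neg_excessEnergy_le (β x b ε s : ℝ) (hβ : 1 ≤ β) (hb : 0 < b)
    (hε : 0 < ε) :
    |s - softThresh x b| * Real.exp (-β * excessEnergy x b s) ≤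
      ε * Real.exp (-β * excessEnergy x b s) +
        Real.exp (-(β - 1) * (ε ^ 2 / (2 * b))) *
          (|s - softThresh x b| * Real.exp (-(1 / (2 * b)) * (s - softThresh x b) ^ 2)) := by
  rcases le_or_gt |s - softThresh x b| ε with h | h
  · have h1 := mul_le_mul_of_nonneg_right h (Real.exp_pos (-β * excessEnergy x b s)).le
    have : 0 ≤ Real.exp (-(β - 1) * (ε ^ 2 / (2 * b))) *
      (|s - softThresh x b| * Real.exp (-(1 / (2 * b)) * (s - softThresh x b) ^ 2)) := by
      positivity
    linarith
  · have h1 : Real.exp (-β * excessEnergy x b s) ≤ Real.exp (-(β - 1) * (ε ^ 2 / (2 * b))) *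
        Real.exp (-(1 / (2 * b)) * (s - softThresh x b) ^ 2) := by
      rw [← Real.exp_add]
      refine (exp_neg_excessEnergy_le β x b s (by linarith) hb).trans (Real.exp_le_exp.2 ?_)
      have h2 : ε ^ 2 / (2 * b) ≤ (s - softThresh x b) ^ 2 / (2 * b) := by
        rw [← sq_abs (s - softThresh x b)]
        gcongr
      have h3 := mul_le_mul_of_nonneg_left h2 (sub_nonneg.2 hβ)
      calc -(β / (2 * b)) * (s - softThresh x b) ^ 2
          = -((β - 1) * ((s - softThresh x b) ^ 2 / (2 * b))) +
            -(1 / (2 * b)) * (s - softThresh x b) ^ 2 := by ring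
        _ ≤ _ := by linarith
    have h4 := mul_le_mul_of_nonneg_left h1 (abs_nonneg (s - softThresh x b))
    have h5 : 0 ≤ ε * Real.exp (-β * excessEnergy x b s) := by positivity
    linarith

lemma abs_ampF_sub_softThresh_le (β x b ε : ℝ) (hβ : 1 ≤ β) (hb : 0 < b) (hε : 0 < ε) :
    |ampF β x b - softThresh x b| ≤ ε + Real.exp (-(β - 1) * (ε ^ 2 / (2 * b))) *
      (∫ s, |s - softThresh x b| * Real.exp (-(1 / (2 * b)) * (s - softThresh x b) ^ 2)) /
        (2 / β * Real.exp (-(2 + 1 / (2 * b)))) := by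
  have hβ0 : 0 < β := by linarith
  have hexp := integrable_exp_neg_excessEnergy β x b hβ0 hb
  have hmul := integrable_sub_mul_exp_neg_excessEnergy β x b hβ0 hb
  have hgauss := integrable_abs_sub_mul_gaussian (1 / (2 * b)) (softThresh x b) (by positivity)
  have hpos : 0 < ∫ s, Real.exp (-β * excessEnergy x b s) := integral_exp_pos hexp
  have hJ : 0 ≤ ∫ s, |s - softThresh x b| *
      Real.exp (-(1 / (2 * b)) * (s - softThresh x b) ^ 2) :=
    integral_nonneg fun s => by positivity
  have hnum : |∫ s, (s - softThresh x b) * Real.exp (-β * excessEnergy x b s)| ≤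
      ε * (∫ s, Real.exp (-β * excessEnergy x b s)) +
        Real.exp (-(β - 1) * (ε ^ 2 / (2 * b))) *
          ∫ s, |s - softThresh x b| * Real.exp (-(1 / (2 * b)) * (s - softThresh x b) ^ 2) := by
    rw [← integral_const_mul, ← integral_const_mul,
      ← integral_add (hexp.const_mul _) (hgauss.const_mul _)]
    refine abs_integral_le_integral_abs.trans (integral_mono hmul.abs
      ((hexp.const_mul _).add (hgauss.const_mul _)) fun s => ?_)
    simp only [abs_mul, Real.abs_exp]
    exact abs_sub_mul_exp_neg_excessEnergy_le β x b ε s hβ hb hε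
  rw [ampF_sub_softThresh β x b hβ0 hb, abs_div, abs_of_pos hpos]
  refine (div_le_div_of_nonneg_right hnum hpos.le).trans ?_
  rw [add_div, mul_div_cancel_right₀ _ hpos.ne']
  gcongr
  exact le_integral_exp_neg_excessEnergy β x b hβ hb

lemma tendsto_mul_exp_neg_mul_atTop (c : ℝ) (hc : 0 < c) :
    Tendsto (fun β : ℝ => β * Real.exp (-c * β)) atTop (nhds 0) := by
  simpa using tendsto_rpow_mul_exp_neg_mul_atTop_nhds_zero 1 c hc

/-- For every `x ∈ ℝ` and `b > 0`, the mean `F_β(x; b)` of the probability density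
`f_β(·; x, b)` converges, as `β → ∞`, to the soft-thresholding value
`η(x; b) = sign(x)·(|x| − b)₊`. -/
theorem ampF_tendsto_softThresh (x b : ℝ) (hb : 0 < b) :
    Tendsto (fun β : ℝ => ampF β x b) atTop (nhds (softThresh x b)) := by
  rw [Metric.tendsto_atTop']
  refine fun ε hε => ?_
  set J := ∫ s, |s - softThresh x b| * Real.exp (-(1 / (2 * b)) * (s - softThresh x b) ^ 2)
    with hJ
  set c := (ε / 2) ^ 2 / (2 * b) with hc
  have hlim : Tendsto (fun β : ℝ => Real.exp (-(β - 1) * c) * J /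
      (2 / β * Real.exp (-(2 + 1 / (2 * b))))) atTop (nhds 0) := by
    have h := (tendsto_mul_exp_neg_mul_atTop c (by positivity)).const_mul
      (Real.exp c * J / (2 * Real.exp (-(2 + 1 / (2 * b)))))
    rw [mul_zero] at h
    refine h.congr' ((eventually_gt_atTop 0).mono fun β hβ => ?_)
    have : Real.exp (-(β - 1) * c) = Real.exp c * Real.exp (-c * β) := by
      rw [← Real.exp_add]; congr 1; ring
    simp only [this]
    field_simp
  obtain ⟨N, hN⟩ := eventually_atTop.1 (hlim.eventually_lt_const (half_pos hε))
  refine ⟨max N 1, fun β hβ => ?_⟩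
  have h1 := hN β ((le_max_left _ _).trans hβ.le)
  have h2 := abs_ampF_sub_softThresh_le β x b (ε / 2) ((le_max_right _ _).trans hβ.le) hb
    (half_pos hε)
  rw [Real.dist_eq]
  linarith
end

section
/- Fix b > 0 and x ∈ ℝ with |x| ≠ b. Then β · G_β(x; b) converges, as β → ∞, to b · η'(x; b), where η'(x; b) = 1 if |x| > b and η'(x; b) = 0 if |x| < b. Equivalently: if |x| > b then lim_{β→∞} β · G_β(x; b) = b, and if |x| < b then lim_{β→∞} β · G_β(x; b) = 0. -/
open MeasureTheory Filter

/-- Variance G_β(x; b) of the probability density f_β(·; x, b). -/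
noncomputable def ampG (β x b : ℝ) : ℝ :=
  (∫ s : ℝ, s ^ 2 * ampWeight β x b s) / ampZ β x b - (ampF β x b) ^ 2

/-- Variance of the probability density proportional to `w`. -/
noncomputable def weightVariance (w : ℝ → ℝ) : ℝ :=
  (∫ s : ℝ, s ^ 2 * w s) / (∫ s : ℝ, w s) - ((∫ s : ℝ, s * w s) / (∫ s : ℝ, w s)) ^ 2

theorem ampG_eq_weightVariance (β x b : ℝ) :
    ampG β x b = weightVariance (ampWeight β x b) := rfl

theorem ampG_neg (β x b : ℝ) : ampG β (-x) b = ampG β x b := by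
  have hw (s : ℝ) : ampWeight β (-x) b s = ampWeight β x b (-s) := by
    unfold ampWeight
    rw [abs_neg]
    congr 1
    ring
  have h0 : ∫ s, ampWeight β (-x) b s = ∫ s, ampWeight β x b s := by
    simp_rw [hw]
    exact integral_neg_eq_self (fun s => ampWeight β x b s) volume
  have h1 : ∫ s, s * ampWeight β (-x) b s = -∫ s, s * ampWeight β x b s := by
    rw [← integral_neg_eq_self (fun s => s * ampWeight β x b s) volume, ← integral_neg]
    simp_rw [hw, neg_mul, neg_neg]
  have h2 : ∫ s, s ^ 2 * ampWeight β (-x) b s = ∫ s, s ^ 2 * ampWeight β x b s := by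
    rw [← integral_neg_eq_self (fun s => s ^ 2 * ampWeight β x b s) volume]
    simp_rw [hw, neg_sq]
  rw [ampG_eq_weightVariance, ampG_eq_weightVariance, weightVariance, weightVariance, h0, h1, h2]
  ring

/-- The variance of a weight scales quadratically under an affine change of variables. -/
theorem weightVariance_of_affine {w v : ℝ → ℝ} {a m K : ℝ} (ha : a ≠ 0) (hK : K ≠ 0)
    (h : ∀ t, w (m + t / a) = K * v t) (hi0 : Integrable v)
    (hi1 : Integrable fun t => t * v t) (hi2 : Integrable fun t => t ^ 2 * v t)
    (hz : ∫ t, v t ≠ 0) :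
    weightVariance w = weightVariance v / a ^ 2 := by
  have key (f : ℝ → ℝ) : ∫ s, f s = |a|⁻¹ * ∫ t, f (m + t / a) := by
    rw [Measure.integral_comp_div (fun t => f (m + t)) a, integral_add_left_eq_self, smul_eq_mul,
      inv_mul_cancel_left₀ (abs_ne_zero.2 ha)]
  have e0 : ∫ s, w s = |a|⁻¹ * (K * ∫ t, v t) := by
    simp_rw [key w, h, integral_const_mul]
  have e1 : ∫ s, s * w s = |a|⁻¹ * (K * (m * (∫ t, v t) + (∫ t, t * v t) / a)) := by
    rw [key, ← integral_const_mul m, ← integral_div, ← integral_add (hi0.const_mul _)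
      (hi1.div_const _), ← integral_const_mul K]
    simp_rw [h]
    congr! 3 with t
    ring
  have e2 : ∫ s, s ^ 2 * w s = |a|⁻¹ * (K * (m ^ 2 * (∫ t, v t) + 2 * m / a * (∫ t, t * v t)
      + (∫ t, t ^ 2 * v t) / a ^ 2)) := by
    rw [key, ← integral_const_mul (m ^ 2), ← integral_const_mul (2 * m / a), ← integral_div,
      ← integral_add (hi0.const_mul _) (hi1.const_mul _),
      ← integral_add (by exact (hi0.const_mul _).add (hi1.const_mul _)) (hi2.div_const _),
      ← integral_const_mul K]
    simp_rw [h]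
    congr! 3 with t
    ring
  have ha' : |a| ≠ 0 := abs_ne_zero.2 ha
  rw [weightVariance, weightVariance, e0, e1, e2]
  field_simp
  ring

/-- If the weights `w β` are, after affine changes of variables with scales `a β`, dominated by
`g` and pointwise convergent to `v`, their rescaled variances converge to the variance of `v`. -/
theorem tendsto_sq_mul_weightVariance {w u : ℝ → ℝ → ℝ} {v g : ℝ → ℝ} {a K : ℝ → ℝ} {m : ℝ}
    (ha : ∀ᶠ β in atTop, a β ≠ 0) (hK : ∀ β, K β ≠ 0)
    (h : ∀ᶠ β in atTop, ∀ t, w β (m + t / a β) = K β * u β t)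
    (hu : ∀ β, Continuous (u β)) (hug : ∀ᶠ β in atTop, ∀ t, |u β t| ≤ g t)
    (hg : ∀ k : ℕ, k ≤ 2 → Integrable fun t => |t| ^ k * g t)
    (hlim : ∀ t, Tendsto (fun β => u β t) atTop (nhds (v t))) (hz : ∫ t, v t ≠ 0) :
    Tendsto (fun β => a β ^ 2 * weightVariance (w β)) atTop (nhds (weightVariance v)) := by
  have bound (k : ℕ) {β : ℝ} (hβ : ∀ t, |u β t| ≤ g t) (t : ℝ) :
      ‖t ^ k * u β t‖ ≤ |t| ^ k * g t := by
    rw [Real.norm_eq_abs, abs_mul, abs_pow]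
    gcongr
    exact hβ t
  have meas (k : ℕ) (β : ℝ) : AEStronglyMeasurable (fun t => t ^ k * u β t) volume :=
    ((continuous_pow k).mul (hu β)).aestronglyMeasurable
  have hint (k : ℕ) (hk : k ≤ 2) {β : ℝ} (hβ : ∀ t, |u β t| ≤ g t) :
      Integrable (fun t => t ^ k * u β t) :=
    (hg k hk).mono' (meas k β) (ae_of_all _ (bound k hβ))
  have hmom (k : ℕ) (hk : k ≤ 2) :
      Tendsto (fun β => ∫ t, t ^ k * u β t) atTop (nhds (∫ t, t ^ k * v t)) :=
    tendsto_integral_filter_of_dominated_convergence _ (.of_forall (meas k))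
      (hug.mono fun β hβ => ae_of_all _ (bound k hβ)) (hg k hk)
      (ae_of_all _ fun t => (hlim t).const_mul _)
  have h0 := hmom 0 (by norm_num)
  have h1 := hmom 1 (by norm_num)
  have h2 := hmom 2 le_rfl
  simp only [pow_zero, one_mul, pow_one] at h0 h1
  have hvar : Tendsto (fun β => weightVariance (u β)) atTop (nhds (weightVariance v)) :=
    (h2.div h0 hz).sub ((h1.div h0 hz).pow 2)
  refine hvar.congr' ?_
  filter_upwards [ha, h, hug, h0.eventually_ne hz] with β haβ hβ hugβ hzβ
  have hi0 := hint 0 (by norm_num) hugβ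
  have hi1 := hint 1 (by norm_num) hugβ
  simp only [pow_zero, one_mul, pow_one] at hi0 hi1
  rw [weightVariance_of_affine haβ (hK β) hβ hi0 hi1 (hint 2 le_rfl hugβ) hzβ]
  field_simp

theorem integrable_abs_pow_mul_exp_neg_mul_abs {c : ℝ} (hc : 0 < c) (k : ℕ) :
    Integrable fun t : ℝ => |t| ^ k * Real.exp (-(c * |t|)) := by
  refine Integrable.of_integral_ne_zero ?_
  have hpos := Real.integral_rpow_mul_exp_neg_mul_Ioi (a := k + 1) (r := c) (by positivity) hc
  simp only [add_sub_cancel_right, Real.rpow_natCast] at hpos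
  rw [integral_comp_abs (f := fun t => t ^ k * Real.exp (-(c * t))), hpos]
  have := Real.Gamma_pos_of_pos (s := (k : ℝ) + 1) (by positivity)
  positivity

theorem integrable_abs_pow_mul_exp_neg_mul_sq {c : ℝ} (hc : 0 < c) (k : ℕ) :
    Integrable fun t : ℝ => |t| ^ k * Real.exp (-c * t ^ 2) := by
  have h := (integrable_rpow_mul_exp_neg_mul_sq hc (s := k)
    (by have := k.cast_nonneg (α := ℝ); linarith)).norm
  simpa [Real.rpow_natCast, abs_mul, abs_pow] using h

theorem weightVariance_exp_neg_mul_sq {c : ℝ} (hc : 0 < c) :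
    weightVariance (fun t => Real.exp (-c * t ^ 2)) = (2 * c)⁻¹ := by
  have i0 := integrable_exp_neg_mul_sq hc
  have i1 := integrable_mul_exp_neg_mul_sq hc
  have i2 : Integrable fun t : ℝ => t ^ 2 * Real.exp (-c * t ^ 2) := by
    simpa using integrable_abs_pow_mul_exp_neg_mul_sq hc 2
  have e1 : ∫ t : ℝ, t * Real.exp (-c * t ^ 2) = 0 := by
    have := integral_neg_eq_self (fun t : ℝ => t * Real.exp (-c * t ^ 2)) volume
    simp only [neg_sq, neg_mul _ (Real.exp _), integral_neg] at this
    linarith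
  have e2 : (∫ t : ℝ, Real.exp (-c * t ^ 2)) - 2 * c * ∫ t : ℝ, t ^ 2 * Real.exp (-c * t ^ 2)
      = 0 := by
    rw [← integral_const_mul, ← integral_sub i0 (i2.const_mul _)]
    refine integral_eq_zero_of_hasDerivAt_of_integrable (fun t => ?_) (i0.sub (i2.const_mul _)) i1
    convert! (hasDerivAt_id t).mul (((hasDerivAt_pow 2 t).const_mul (-c)).exp) using 1
    simp
    ring
  have hz : ∫ t : ℝ, Real.exp (-c * t ^ 2) ≠ 0 := (integral_exp_pos i0).ne'
  have e3 : ∫ t : ℝ, t ^ 2 * Real.exp (-c * t ^ 2)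
      = (2 * c)⁻¹ * ∫ t : ℝ, Real.exp (-c * t ^ 2) := by
    rw [eq_inv_mul_iff_mul_eq₀ (by positivity)]
    linarith
  rw [weightVariance, e1, e3, mul_div_cancel_right₀ _ hz]
  simp

theorem tendsto_mul_ampG_of_lt {x b : ℝ} (hb : 0 < b) (hx : b < x) :
    Tendsto (fun β => β * ampG β x b) atTop (nhds b) := by
  have hc : 0 < (2 * b)⁻¹ := by positivity
  have hm : 0 < x - b := by linarith
  have hlim (t : ℝ) : ∀ᶠ β in atTop, 0 ≤ x - b + t / √β := by
    have : Tendsto (fun β => x - b + t / √β) atTop (nhds (x - b + 0)) :=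
      (Real.tendsto_sqrt_atTop.const_div_atTop t).const_add _
    exact (this.eventually_const_lt (by simpa using hm)).mono fun _ h => h.le
  have key := tendsto_sq_mul_weightVariance (w := fun β => ampWeight β x b)
    (u := fun β t => Real.exp (-(2 * b)⁻¹ * t ^ 2
      - β * (|x - b + t / √β| - (x - b + t / √β))))
    (v := fun t => Real.exp (-(2 * b)⁻¹ * t ^ 2)) (g := fun t => Real.exp (-(2 * b)⁻¹ * t ^ 2))
    (a := fun β => √β) (K := fun β => Real.exp (-β * (x - b / 2))) (m := x - b)
    ((eventually_gt_atTop 0).mono fun β hβ => (Real.sqrt_pos.2 hβ).ne')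
    (fun β => Real.exp_ne_zero _) ?_ (fun β => by fun_prop) ?_
    (fun k _ => integrable_abs_pow_mul_exp_neg_mul_sq hc k) ?_
    (integral_exp_pos (integrable_exp_neg_mul_sq hc)).ne'
  · rw [weightVariance_exp_neg_mul_sq hc] at key
    simp only [mul_inv, inv_inv, mul_inv_cancel_left₀ (two_ne_zero' ℝ)] at key
    refine key.congr' ((eventually_ge_atTop 0).mono fun β hβ => ?_)
    simp only [Real.sq_sqrt hβ, ampG_eq_weightVariance]
  · filter_upwards [eventually_gt_atTop 0] with β hβ t
    rw [ampWeight, ← Real.exp_add]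
    congr 1
    have hs := Real.sqrt_pos.2 hβ
    have hβs : β = √β ^ 2 := (Real.sq_sqrt hβ.le).symm
    generalize √β = r at *
    subst hβs
    generalize |x - b + t / r| = A
    field_simp
    ring
  · filter_upwards [eventually_ge_atTop 0] with β hβ t
    rw [Real.abs_exp, Real.exp_le_exp]
    have := mul_nonneg hβ (sub_nonneg.2 (le_abs_self (x - b + t / √β)))
    linarith
  · intro t
    refine tendsto_const_nhds.congr' ((hlim t).mono fun β hβ => ?_)
    simp only [abs_of_nonneg hβ, sub_self, mul_zero, sub_zero]

theorem tendsto_mul_ampG_of_abs_lt {x b : ℝ} (hb : 0 < b) (hx : |x| < b) :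
    Tendsto (fun β => β * ampG β x b) atTop (nhds 0) := by
  have hc : 0 < 1 - |x| / b := sub_pos.2 ((div_lt_one hb).2 hx)
  have hle (t : ℝ) : -|t| + x * t / b ≤ -((1 - |x| / b) * |t|) := by
    have : x * t / b ≤ |x| * |t| / b := by
      rw [← abs_mul]
      gcongr
      exact le_abs_self _
    calc -|t| + x * t / b ≤ -|t| + |x| * |t| / b := by gcongr
      _ = -((1 - |x| / b) * |t|) := by ring
  have hint : Integrable fun t : ℝ => Real.exp (-|t| + x * t / b) := by
    refine (integrable_abs_pow_mul_exp_neg_mul_abs hc 0).mono'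
      (by fun_prop : Continuous _).aestronglyMeasurable (ae_of_all _ fun t => ?_)
    simpa using hle t
  have key := tendsto_sq_mul_weightVariance (w := fun β => ampWeight β x b)
    (u := fun β t => Real.exp (-|t| + x * t / b - t ^ 2 / (2 * b) / β))
    (v := fun t => Real.exp (-|t| + x * t / b))
    (g := fun t => Real.exp (-((1 - |x| / b) * |t|)))
    (a := fun β => β) (K := fun β => Real.exp (-β * x ^ 2 / (2 * b))) (m := 0)
    (eventually_ne_atTop 0) (fun β => Real.exp_ne_zero _) ?_ (fun β => by fun_prop) ?_
    (fun k _ => integrable_abs_pow_mul_exp_neg_mul_abs hc k) ?_ (integral_exp_pos hint).ne'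
  · have := tendsto_inv_atTop_zero.mul key
    rw [zero_mul] at this
    refine this.congr' ((eventually_gt_atTop 0).mono fun β hβ => ?_)
    simp only [ampG_eq_weightVariance]
    field_simp
  · filter_upwards [eventually_gt_atTop 0] with β hβ t
    rw [ampWeight, ← Real.exp_add, zero_add, abs_div, abs_of_pos hβ]
    congr 1
    field_simp
    ring
  · filter_upwards [eventually_ge_atTop 0] with β hβ t
    rw [Real.abs_exp, Real.exp_le_exp]
    have : 0 ≤ t ^ 2 / (2 * b) / β := by positivity
    linarith [hle t]
  · intro t
    have := (tendsto_id.const_div_atTop (t ^ 2 / (2 * b))).const_sub (-|t| + x * t / b)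
    rw [sub_zero] at this
    exact (Real.continuous_exp.tendsto _).comp this

/-- Fix `b > 0` and `x ∈ ℝ` with `|x| ≠ b`.  Then `β · G_β(x; b)` converges, as
`β → ∞`, to `b · η'(x; b)`, where `η'(x; b) = 1` if `|x| > b` and `η'(x; b) = 0`
if `|x| < b`. -/
theorem beta_ampG_tendsto (x b : ℝ) (hb : 0 < b) (hxb : |x| ≠ b) :
    Tendsto (fun β : ℝ => β * ampG β x b) atTop
      (nhds (b * (if b < |x| then (1 : ℝ) else 0))) := by
  rcases hxb.lt_or_gt with h | h
  · rw [if_neg h.not_gt, mul_zero]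
    exact tendsto_mul_ampG_of_abs_lt hb h
  · rw [if_pos h, mul_one]
    rcases lt_abs.1 h with h | h
    · exact tendsto_mul_ampG_of_lt hb h
    · simpa only [ampG_neg] using tendsto_mul_ampG_of_lt hb h
end

section
/- Fix b > 0 and x ∈ ℝ with |x| < b (so that the minimizer of s ↦ |s| + (s − x)²/(2b) is s* = 0). Then G_β(x; b) = Θ(1/β²) as β → ∞: there exist constants c, C > 0 (depending on x and b) and β₀ > 0 such that for all β ≥ β₀, c/β² ≤ G_β(x; b) ≤ C/β². -/
open MeasureTheory Filter

lemma integral_exp_neg_mul_abs {a : ℝ} (ha : 0 < a) :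
    ∫ s : ℝ, Real.exp (-a * |s|) = 2 / a := by
  rw [integral_comp_abs (f := fun s => Real.exp (-a * s)),
    integral_exp_mul_Ioi (neg_neg_of_pos ha)]
  simp
  ring

lemma integrable_exp_neg_mul_abs {a : ℝ} (ha : 0 < a) :
    Integrable fun s : ℝ => Real.exp (-a * |s|) := by
  by_contra h
  have h₁ := integral_exp_neg_mul_abs ha
  rw [integral_undef h] at h₁
  exact (div_pos two_pos ha).ne h₁

lemma sq_mul_exp_neg_mul_abs_le {a : ℝ} (ha : 0 < a) (s : ℝ) :
    s ^ 2 * Real.exp (-a * |s|) ≤ 8 / a ^ 2 * Real.exp (-(a / 2) * |s|) := by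
  have h := Real.quadratic_le_exp_of_nonneg (x := a / 2 * |s|) (by positivity)
  have h₁ : s ^ 2 ≤ 8 / a ^ 2 * Real.exp (a / 2 * |s|) := by
    rw [div_mul_eq_mul_div, le_div_iff₀ (by positivity)]
    have h₂ : 0 ≤ a / 2 * |s| := by positivity
    have h₃ : (a / 2 * |s|) ^ 2 = a ^ 2 * s ^ 2 / 4 := by rw [mul_pow, sq_abs]; ring
    linarith
  calc s ^ 2 * Real.exp (-a * |s|)
      ≤ 8 / a ^ 2 * Real.exp (a / 2 * |s|) * Real.exp (-a * |s|) := by gcongr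
    _ = 8 / a ^ 2 * Real.exp (-(a / 2) * |s|) := by
      rw [mul_assoc, ← Real.exp_add]
      ring_nf

lemma integrable_sq_mul_exp_neg_mul_abs {a : ℝ} (ha : 0 < a) :
    Integrable fun s : ℝ => s ^ 2 * Real.exp (-a * |s|) := by
  refine ((integrable_exp_neg_mul_abs (half_pos ha)).const_mul (8 / a ^ 2)).mono'
    (by fun_prop) (.of_forall fun s => ?_)
  rw [Real.norm_of_nonneg (by positivity)]
  exact sq_mul_exp_neg_mul_abs_le ha s

lemma integral_sq_mul_exp_neg_mul_abs_le {a : ℝ} (ha : 0 < a) :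
    ∫ s : ℝ, s ^ 2 * Real.exp (-a * |s|) ≤ 32 / a ^ 3 := by
  calc ∫ s : ℝ, s ^ 2 * Real.exp (-a * |s|)
      ≤ ∫ s : ℝ, 8 / a ^ 2 * Real.exp (-(a / 2) * |s|) :=
        integral_mono (integrable_sq_mul_exp_neg_mul_abs ha)
          ((integrable_exp_neg_mul_abs (half_pos ha)).const_mul _)
          (sq_mul_exp_neg_mul_abs_le ha)
    _ = 32 / a ^ 3 := by
      rw [integral_const_mul, integral_exp_neg_mul_abs (half_pos ha)]
      field_simp
      norm_num

lemma continuous_ampWeight (β x b : ℝ) : Continuous (ampWeight β x b) := by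
  unfold ampWeight
  fun_prop

lemma ampWeight_pos (β x b s : ℝ) : 0 < ampWeight β x b s := Real.exp_pos _

lemma ampWeight_le {β x b : ℝ} (hβ : 0 < β) (hb : 0 < b) (s : ℝ) :
    ampWeight β x b s ≤
      Real.exp (-(β * x ^ 2 / (2 * b))) * Real.exp (-((1 - |x| / b) * β) * |s|) := by
  rw [ampWeight, ← Real.exp_add, Real.exp_le_exp]
  have h₁ : β / b * (x * s) ≤ β / b * (|x| * |s|) := by
    rw [← abs_mul]
    gcongr
    exact le_abs_self _
  have h₂ : 0 ≤ β / (2 * b) * s ^ 2 := by positivity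
  have h₃ : β / (2 * b) * (s - x) ^ 2 =
      β / (2 * b) * s ^ 2 - β / b * (x * s) + β * x ^ 2 / (2 * b) := by
    field_simp
    ring
  have h₄ : -((1 - |x| / b) * β) * |s| = -β * |s| + β / b * (|x| * |s|) := by
    field_simp
    ring
  rw [h₃, h₄]
  linarith

lemma le_ampWeight {β x b s : ℝ} (hb : 0 < b) (hxb : |x| < b) (hβ : 1 / (2 * b) ≤ β)
    (hs : |s| ≤ 1 / β) :
    Real.exp (-(β * x ^ 2 / (2 * b))) * Real.exp (-3) ≤ ampWeight β x b s := by
  have hβ₀ : 0 < β := lt_of_lt_of_le (by positivity) hβ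
  have hβb : 1 ≤ β * (2 * b) := (div_le_iff₀ (by positivity)).1 hβ
  have hβs : |s| * β ≤ 1 := (le_div_iff₀ hβ₀).1 hs
  rw [ampWeight, ← Real.exp_add, Real.exp_le_exp]
  have h₁ : -(β / b * (x * s)) ≤ 1 := by
    calc -(β / b * (x * s)) ≤ β / b * (|x| * |s|) := by
          rw [← abs_mul, ← mul_neg]
          gcongr
          exact neg_le_abs _
      _ ≤ β / b * (b * |s|) := by gcongr
      _ = |s| * β := by field_simp
      _ ≤ 1 := hβs
  have h₂ : β / (2 * b) * s ^ 2 ≤ 1 := by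
    rw [div_mul_eq_mul_div, div_le_one (by positivity), ← sq_abs]
    have h : (|s| * β) * (|s| * β) ≤ 1 := by
      nlinarith [mul_nonneg (abs_nonneg s) hβ₀.le]
    refine le_of_mul_le_mul_left ?_ hβ₀
    linarith
  have h₃ : β / (2 * b) * (s - x) ^ 2 =
      β / (2 * b) * s ^ 2 - β / b * (x * s) + β * x ^ 2 / (2 * b) := by
    field_simp
    ring
  rw [h₃]
  linarith

section Bounds

variable {β x b : ℝ}

lemma gap_mul_pos (hβ : 0 < β) (hb : 0 < b) (hxb : |x| < b) : 0 < (1 - |x| / b) * β :=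
  mul_pos (sub_pos.2 ((div_lt_one hb).2 hxb)) hβ

lemma integrable_ampWeight (hβ : 0 < β) (hb : 0 < b) (hxb : |x| < b) :
    Integrable (ampWeight β x b) := by
  refine ((integrable_exp_neg_mul_abs (gap_mul_pos hβ hb hxb)).const_mul
    (Real.exp (-(β * x ^ 2 / (2 * b))))).mono'
    (continuous_ampWeight β x b).aestronglyMeasurable (.of_forall fun s => ?_)
  rw [Real.norm_of_nonneg (ampWeight_pos ..).le]
  exact ampWeight_le hβ hb s

lemma sq_mul_ampWeight_le (hβ : 0 < β) (hb : 0 < b) (s : ℝ) :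
    s ^ 2 * ampWeight β x b s ≤ Real.exp (-(β * x ^ 2 / (2 * b))) *
      (s ^ 2 * Real.exp (-((1 - |x| / b) * β) * |s|)) := by
  rw [mul_left_comm]
  exact mul_le_mul_of_nonneg_left (ampWeight_le hβ hb s) (sq_nonneg s)

lemma integrable_sq_mul_ampWeight (hβ : 0 < β) (hb : 0 < b) (hxb : |x| < b) :
    Integrable fun s => s ^ 2 * ampWeight β x b s := by
  have hc := continuous_ampWeight β x b
  refine ((integrable_sq_mul_exp_neg_mul_abs (gap_mul_pos hβ hb hxb)).const_mul
    (Real.exp (-(β * x ^ 2 / (2 * b))))).mono'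
    (by fun_prop) (.of_forall fun s => ?_)
  rw [Real.norm_of_nonneg (mul_nonneg (sq_nonneg s) (ampWeight_pos ..).le)]
  exact sq_mul_ampWeight_le hβ hb s

lemma integrable_mul_ampWeight (hβ : 0 < β) (hb : 0 < b) (hxb : |x| < b) :
    Integrable fun s => s * ampWeight β x b s := by
  have hc := continuous_ampWeight β x b
  refine ((integrable_ampWeight hβ hb hxb).add (integrable_sq_mul_ampWeight hβ hb hxb)).mono'
    (by fun_prop) (.of_forall fun s => ?_)
  have hw := ampWeight_pos β x b s
  rw [norm_mul, Real.norm_of_nonneg hw.le, Real.norm_eq_abs, Pi.add_apply, ← sq_abs s]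
  nlinarith [sq_nonneg (|s| - 1), abs_nonneg s]

lemma ampZ_le (hβ : 0 < β) (hb : 0 < b) (hxb : |x| < b) :
    ampZ β x b ≤ Real.exp (-(β * x ^ 2 / (2 * b))) * (2 / ((1 - |x| / b) * β)) := by
  have ha := gap_mul_pos hβ hb hxb
  rw [← integral_exp_neg_mul_abs ha, ← integral_const_mul]
  exact integral_mono (integrable_ampWeight hβ hb hxb)
    ((integrable_exp_neg_mul_abs ha).const_mul _) (ampWeight_le hβ hb)

lemma integral_sq_mul_ampWeight_le (hβ : 0 < β) (hb : 0 < b) (hxb : |x| < b) :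
    ∫ s, s ^ 2 * ampWeight β x b s ≤
      Real.exp (-(β * x ^ 2 / (2 * b))) * (32 / ((1 - |x| / b) * β) ^ 3) := by
  have ha := gap_mul_pos hβ hb hxb
  refine le_trans ?_ (mul_le_mul_of_nonneg_left (integral_sq_mul_exp_neg_mul_abs_le ha)
    (Real.exp_pos _).le)
  rw [← integral_const_mul]
  exact integral_mono (integrable_sq_mul_ampWeight hβ hb hxb)
    ((integrable_sq_mul_exp_neg_mul_abs ha).const_mul _) (sq_mul_ampWeight_le hβ hb)

lemma intervalIntegral_mul_le_integral_mul_ampWeight {p : ℝ → ℝ} (hp : Continuous p)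
    (hp₀ : ∀ s, 0 ≤ p s) (hpw : Integrable fun s => p s * ampWeight β x b s)
    (hb : 0 < b) (hxb : |x| < b) (hβ : 1 / (2 * b) ≤ β) :
    (∫ s in (-(1 / β))..(1 / β), p s) *
        (Real.exp (-(β * x ^ 2 / (2 * b))) * Real.exp (-3)) ≤
      ∫ s, p s * ampWeight β x b s := by
  have hβ₀ : 0 < β := lt_of_lt_of_le (by positivity) hβ
  have hle : -(1 / β) ≤ 1 / β := by
    have : 0 < 1 / β := by positivity
    linarith
  have hc := continuous_ampWeight β x b
  rw [← intervalIntegral.integral_mul_const]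
  calc _ ≤ ∫ s in (-(1 / β))..(1 / β), p s * ampWeight β x b s := by
        refine intervalIntegral.integral_mono_on hle
          (Continuous.intervalIntegrable (by fun_prop) _ _)
          (Continuous.intervalIntegrable (by fun_prop) _ _) fun s hs => ?_
        exact mul_le_mul_of_nonneg_left (le_ampWeight hb hxb hβ (abs_le.2 hs)) (hp₀ s)
    _ ≤ _ := by
        rw [intervalIntegral.integral_of_le hle]
        exact setIntegral_le_integral hpw
          (.of_forall fun s => mul_nonneg (hp₀ s) (ampWeight_pos ..).le)

lemma le_ampZ (hb : 0 < b) (hxb : |x| < b) (hβ : 1 / (2 * b) ≤ β) :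
    2 / β * (Real.exp (-(β * x ^ 2 / (2 * b))) * Real.exp (-3)) ≤ ampZ β x b := by
  have hβ₀ : 0 < β := lt_of_lt_of_le (by positivity) hβ
  have h := intervalIntegral_mul_le_integral_mul_ampWeight (p := fun _ => 1)
    continuous_const (fun _ => zero_le_one)
    (by simpa using integrable_ampWeight hβ₀ hb hxb) hb hxb hβ
  simp only [one_mul, intervalIntegral.integral_const, smul_eq_mul, mul_one] at h
  refine le_trans (le_of_eq ?_) h
  ring

lemma le_integral_sub_sq_mul_ampWeight (hb : 0 < b) (hxb : |x| < b) (hβ : 1 / (2 * b) ≤ β)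
    {m : ℝ} (hm : Integrable fun s => (s - m) ^ 2 * ampWeight β x b s) :
    2 / (3 * β ^ 3) * (Real.exp (-(β * x ^ 2 / (2 * b))) * Real.exp (-3)) ≤
      ∫ s, (s - m) ^ 2 * ampWeight β x b s := by
  have hβ₀ : 0 < β := lt_of_lt_of_le (by positivity) hβ
  refine le_trans ?_ (intervalIntegral_mul_le_integral_mul_ampWeight
    (p := fun s => (s - m) ^ 2) (by fun_prop) (fun s => sq_nonneg _) hm hb hxb hβ)
  rw [intervalIntegral.integral_comp_sub_right (fun s => s ^ 2) m, integral_pow]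
  refine mul_le_mul_of_nonneg_right ?_ (by positivity)
  have h : 0 ≤ 2 * m ^ 2 / β := by positivity
  have h₁ : ((1 / β - m) ^ (2 + 1) - (-(1 / β) - m) ^ (2 + 1)) / ((2 : ℕ) + 1 : ℝ) =
      2 / (3 * β ^ 3) + 2 * m ^ 2 / β := by
    push_cast
    field_simp
    ring
  linarith

lemma integral_sub_ampF_sq_mul_ampWeight (hβ : 0 < β) (hb : 0 < b) (hxb : |x| < b)
    (hZ : ampZ β x b ≠ 0) :
    Integrable (fun s => (s - ampF β x b) ^ 2 * ampWeight β x b s) ∧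
      ∫ s, (s - ampF β x b) ^ 2 * ampWeight β x b s = ampG β x b * ampZ β x b := by
  set m := ampF β x b with hm
  have h₀ := (integrable_ampWeight hβ hb hxb).const_mul (m ^ 2)
  have h₁ := (integrable_mul_ampWeight hβ hb hxb).const_mul (2 * m)
  have h₂ := integrable_sq_mul_ampWeight hβ hb hxb
  have he : (fun s => (s - m) ^ 2 * ampWeight β x b s) = fun s =>
      s ^ 2 * ampWeight β x b s - 2 * m * (s * ampWeight β x b s) +
        m ^ 2 * ampWeight β x b s := by
    ext s
    ring
  have hF : ∫ s, s * ampWeight β x b s = m * ampZ β x b := by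
    rw [hm, ampF, div_mul_cancel₀ _ hZ]
  rw [he]
  have h₂₁ : Integrable fun s =>
      s ^ 2 * ampWeight β x b s - 2 * m * (s * ampWeight β x b s) := h₂.sub h₁
  refine ⟨h₂₁.add h₀, ?_⟩
  rw [integral_add h₂₁ h₀, integral_sub h₂ h₁, integral_const_mul, integral_const_mul,
    hF, ← ampZ, ampG, ← hm, sub_mul, div_mul_cancel₀ _ hZ]
  ring

end Bounds

/-- Fix `b > 0` and `x ∈ ℝ` with `|x| < b`.  Then `G_β(x; b) = Θ(1/β²)` as
`β → ∞`: there exist constants `c, C > 0` and `β₀ > 0` such that for all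
`β ≥ β₀`, `c/β² ≤ G_β(x; b) ≤ C/β²`. -/
theorem ampG_theta_inv_beta_sq (x b : ℝ) (hb : 0 < b) (hxb : |x| < b) :
    ∃ c C β₀ : ℝ, 0 < c ∧ 0 < C ∧ 0 < β₀ ∧
      ∀ β : ℝ, β₀ ≤ β → c / β ^ 2 ≤ ampG β x b ∧ ampG β x b ≤ C / β ^ 2 := by
  have hδ : 0 < 1 - |x| / b := sub_pos.2 ((div_lt_one hb).2 hxb)
  refine ⟨Real.exp (-3) * (1 - |x| / b) / 3, 16 / (Real.exp (-3) * (1 - |x| / b) ^ 3),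
    1 / (2 * b), by positivity, by positivity, by positivity, fun β hβ => ?_⟩
  have hβ₀ : 0 < β := lt_of_lt_of_le (by positivity) hβ
  have hZl := le_ampZ hb hxb hβ
  have hZu := ampZ_le hβ₀ hb hxb
  have hZ : 0 < ampZ β x b := lt_of_lt_of_le (by positivity) hZl
  obtain ⟨hint, hvar⟩ := integral_sub_ampF_sq_mul_ampWeight hβ₀ hb hxb hZ.ne'
  have hl := le_integral_sub_sq_mul_ampWeight hb hxb hβ hint
  rw [hvar] at hl
  have hu := integral_sq_mul_ampWeight_le hβ₀ hb hxb
  generalize Real.exp (-(β * x ^ 2 / (2 * b))) = K at *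
  generalize 1 - |x| / b = δ at *
  constructor
  · refine le_of_mul_le_mul_right (le_trans ?_ hl) hZ
    refine (mul_le_mul_of_nonneg_left hZu (by positivity)).trans (le_of_eq ?_)
    field_simp
  · have hG : ampG β x b ≤ (∫ s, s ^ 2 * ampWeight β x b s) / ampZ β x b :=
      sub_le_self _ (sq_nonneg _)
    refine hG.trans ((div_le_iff₀ hZ).2 (hu.trans ?_))
    refine le_trans (le_of_eq ?_) (mul_le_mul_of_nonneg_left hZl (by positivity))
    field_simp
    ring
end

section
/- Let A be a real n × N matrix, y ∈ ℝⁿ with y in the range of A, and let V = {s ∈ ℝᴺ : As = y} be the (nonempty) affine solution set. Let ν be the measure on ℝᴺ obtained by translating a Haar (Lebesgue) measure on the kernel of A by some fixed point s₀ ∈ V, so ν is supported on V. Assume the basis pursuit problem min{‖s‖₁ : As = y} has a unique minimizer s*. For β > 0, define the probability measure μ_β on ℝᴺ by μ_β(E) = ( ∫_E exp(−β‖s‖₁) dν(s) ) / ( ∫ exp(−β‖s‖₁) dν(s) ). Then μ_β concentrates around s* as β → ∞: for every ε > 0, μ_β( { s : ‖s − s*‖ > ε } ) → 0 as β → ∞.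 -/
open MeasureTheory Filter

/-- `x ↦ exp (-‖x‖)` is integrable for any Haar measure on a finite-dimensional space. -/
theorem integrable_exp_neg_norm {E : Type*} [NormedAddCommGroup E] [NormedSpace ℝ E]
    [FiniteDimensional ℝ E] [MeasurableSpace E] [BorelSpace E] (μ : Measure E)
    [μ.IsAddHaarMeasure] : Integrable (fun x : E => Real.exp (-‖x‖)) μ := by
  set n := Module.finrank ℝ E + 1 with hn
  have hr : (Module.finrank ℝ E : ℝ) < (n : ℝ) := by simp [hn]
  refine ((integrable_one_add_norm (μ := μ) hr).const_mul (Real.exp 1 * n.factorial)).mono'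
    (by fun_prop) (ae_of_all _ fun x => ?_)
  have h0 : 0 < 1 + ‖x‖ := by positivity
  have h := Real.pow_div_factorial_le_exp _ h0.le n
  rw [Real.norm_of_nonneg (Real.exp_pos _).le, Real.rpow_neg h0.le, Real.rpow_natCast,
    ← div_eq_mul_inv, le_div_iff₀ (by positivity)]
  rw [div_le_iff₀ (by positivity), Real.exp_add] at h
  calc Real.exp (-‖x‖) * (1 + ‖x‖) ^ n
      ≤ Real.exp (-‖x‖) * (Real.exp 1 * Real.exp ‖x‖ * n.factorial) := by gcongr
    _ = (Real.exp (-‖x‖) * Real.exp ‖x‖) * (Real.exp 1 * n.factorial) := by ring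
    _ = Real.exp 1 * n.factorial := by rw [← Real.exp_add]; simp

/-- A continuous convex function with a unique minimizer on a closed convex set exceeds its
minimum by a uniform gap away from the minimizer. -/
theorem ConvexOn.exists_gap_of_unique_min {E : Type*} [NormedAddCommGroup E] [NormedSpace ℝ E]
    [ProperSpace E] {V : Set E} {f : E → ℝ} (hf : ConvexOn ℝ V f) (hcont : ContinuousOn f V)
    (hV : IsClosed V) {x₀ : E} (hx₀ : x₀ ∈ V) (hmin : ∀ x ∈ V, x ≠ x₀ → f x₀ < f x)
    {ε : ℝ} (hε : 0 < ε) :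
    ∃ m > 0, ∀ x ∈ V, ε < ‖x - x₀‖ → f x₀ + m ≤ f x := by
  have hproj : ∀ x ∈ V, ε < ‖x - x₀‖ →
      ∃ p ∈ V ∩ Metric.sphere x₀ ε, f p ≤ max (f x₀) (f x) := by
    intro x hx hlt
    have hpos : 0 < ‖x - x₀‖ := hε.trans hlt
    have ht0 : 0 ≤ ε / ‖x - x₀‖ := by positivity
    have ht1 : ε / ‖x - x₀‖ ≤ 1 := (div_le_one hpos).2 hlt.le
    have hseg : AffineMap.lineMap x₀ x (ε / ‖x - x₀‖) ∈ segment ℝ x₀ x := by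
      rw [segment_eq_image_lineMap]
      exact ⟨_, ⟨ht0, ht1⟩, rfl⟩
    refine ⟨_, ⟨hf.1.segment_subset hx₀ hx hseg, ?_⟩, hf.le_on_segment hx₀ hx hseg⟩
    rw [mem_sphere_iff_norm, AffineMap.lineMap_apply_module', add_sub_cancel_right, norm_smul,
      Real.norm_of_nonneg ht0, div_mul_cancel₀ _ hpos.ne']
  rcases (V ∩ Metric.sphere x₀ ε).eq_empty_or_nonempty with hemp | hne
  · refine ⟨1, one_pos, fun x hx hlt => ?_⟩
    obtain ⟨p, hp, -⟩ := hproj x hx hlt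
    simp [hemp] at hp
  · obtain ⟨q, ⟨hqV, hq⟩, hqmin⟩ := ((isCompact_sphere x₀ ε).inter_left hV).exists_isMinOn hne
      (hcont.mono Set.inter_subset_left)
    have hqne : q ≠ x₀ := Metric.ne_of_mem_sphere hq hε.ne'
    refine ⟨f q - f x₀, sub_pos.2 (hmin q hqV hqne), fun x hx hlt => ?_⟩
    obtain ⟨p, hp, hle⟩ := hproj x hx hlt
    have hqx : f q ≤ max (f x₀) (f x) := (hqmin hp).trans hle
    have := hmin q hqV hqne
    rcases le_max_iff.1 hqx with h | h <;> linarith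

/-- The Gibbs measure with energy `f` asymptotically gives no mass to a set on which `f` is
bounded below by a constant exceeding a value of `f`. -/
theorem tendsto_gibbs_ratio_zero {X : Type*} [TopologicalSpace X] [MeasurableSpace X]
    [BorelSpace X] (μ : Measure X) [μ.IsOpenPosMeasure] {f : X → ℝ} (hf : Continuous f)
    (hint : Integrable (fun x => Real.exp (-f x)) μ) {b : ℝ} (hb : ∀ x, b ≤ f x) {x₀ : X} {m : ℝ}
    (hm : 0 < m) {S : Set X} (hS : MeasurableSet S) (hgap : ∀ x ∈ S, f x₀ + m ≤ f x) :
    Tendsto (fun β : ℝ => (∫ x in S, Real.exp (-β * f x) ∂μ) / ∫ x, Real.exp (-β * f x) ∂μ)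
      atTop (nhds 0) := by
  set U : Set X := {x | f x < f x₀ + m / 2} with hU
  have hUo : IsOpen U := isOpen_lt hf continuous_const
  have hUne : U.Nonempty := ⟨x₀, by simp [hU, hm]⟩
  set D := ∫ x in U, Real.exp (-f x) ∂μ
  set C := ∫ x in S, Real.exp (-f x) ∂μ
  have hD : 0 < D := by
    rw [setIntegral_pos_iff_support_of_nonneg_ae (ae_of_all _ fun x => (Real.exp_pos _).le)
      hint.integrableOn]
    have : Function.support (fun x => Real.exp (-f x)) = Set.univ := by
      ext x; simp [Real.exp_ne_zero]
    rw [this, Set.univ_inter]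
    exact hUo.measure_pos μ hUne
  have hsplit : ∀ β x, Real.exp (-β * f x) = Real.exp (-(β - 1) * f x) * Real.exp (-f x) := by
    intro β x
    rw [← Real.exp_add]
    ring_nf
  have hintβ : ∀ β : ℝ, 1 ≤ β → Integrable (fun x => Real.exp (-β * f x)) μ := by
    intro β hβ
    refine (hint.const_mul (Real.exp (-(β - 1) * b))).mono'
      (by fun_prop) (ae_of_all _ fun x => ?_)
    rw [Real.norm_of_nonneg (Real.exp_pos _).le, hsplit]
    gcongr ?_ * _
    exact Real.exp_le_exp.2 (by nlinarith [hb x])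
  have hbound : ∀ β : ℝ, 1 ≤ β →
      (∫ x in S, Real.exp (-β * f x) ∂μ) / ∫ x, Real.exp (-β * f x) ∂μ
        ≤ Real.exp (-(β - 1) * (m / 2)) * (C / D) := by
    intro β hβ
    have hnum : ∫ x in S, Real.exp (-β * f x) ∂μ ≤ Real.exp (-(β - 1) * (f x₀ + m)) * C := by
      rw [← integral_const_mul]
      refine setIntegral_mono_on (hintβ β hβ).integrableOn (hint.const_mul _).integrableOn hS
        fun x hx => ?_
      rw [hsplit]
      gcongr ?_ * _
      exact Real.exp_le_exp.2 (by nlinarith [hgap x hx])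
    have hden : Real.exp (-(β - 1) * (f x₀ + m / 2)) * D ≤ ∫ x, Real.exp (-β * f x) ∂μ := by
      refine le_trans ?_ (setIntegral_le_integral (s := U) (hintβ β hβ)
        (ae_of_all _ fun x => (Real.exp_pos _).le))
      rw [← integral_const_mul]
      refine setIntegral_mono_on (hint.const_mul _).integrableOn (hintβ β hβ).integrableOn
        hUo.measurableSet fun x hx => ?_
      rw [hsplit]
      gcongr ?_ * _
      have : f x < f x₀ + m / 2 := hx
      exact Real.exp_le_exp.2 (by nlinarith)
    have hC : 0 ≤ C := integral_nonneg fun x => (Real.exp_pos _).le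
    refine (div_le_div₀ (by positivity) hnum (by positivity) hden).trans_eq ?_
    rw [mul_div_mul_comm, ← Real.exp_sub]
    ring_nf
  have hlim : Tendsto (fun β : ℝ => Real.exp (-(β - 1) * (m / 2)) * (C / D)) atTop (nhds 0) := by
    have h1 : Tendsto (fun β : ℝ => (β - 1) * (m / 2)) atTop atTop :=
      (tendsto_atTop_add_const_right _ (-1) tendsto_id).atTop_mul_const (by positivity)
    have h2 := (Real.tendsto_exp_neg_atTop_nhds_zero.comp h1).mul_const (C / D)
    simpa only [Function.comp_def, zero_mul, neg_mul] using h2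
  refine tendsto_of_tendsto_of_tendsto_of_le_of_le' tendsto_const_nhds hlim
    (Eventually.of_forall fun β => ?_) ((eventually_ge_atTop 1).mono hbound)
  exact div_nonneg (integral_nonneg fun x => (Real.exp_pos _).le)
    (integral_nonneg fun x => (Real.exp_pos _).le)

/-- Gibbs-measure formulation of basis pursuit (Eq. (2) of the paper): the measure with
density `exp(−β‖s‖₁)` with respect to a translated Haar measure on the affine solution
set `{s : As = y}` concentrates, as `β → ∞`, around the unique basis pursuit minimizer. -/
theorem basis_pursuit_gibbs_concentration
    {n N : ℕ} (A : Matrix (Fin n) (Fin N) ℝ) (y : Fin n → ℝ)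
    (s₀ : Fin N → ℝ) (hs₀ : A.mulVec s₀ = y)
    (μK : Measure (LinearMap.ker A.mulVecLin)) (hμK : μK.IsAddHaarMeasure)
    (sstar : Fin N → ℝ) (hstar : A.mulVec sstar = y)
    (huniq : ∀ s : Fin N → ℝ, A.mulVec s = y → s ≠ sstar → ∑ i, |sstar i| < ∑ i, |s i|) :
    ∀ ε : ℝ, 0 < ε →
      Tendsto (fun β : ℝ =>
        (∫ s in {s : Fin N → ℝ | ε < ‖s - sstar‖}, Real.exp (-β * ∑ i, |s i|)
            ∂(Measure.map (fun k : LinearMap.ker A.mulVecLin => s₀ + (k : Fin N → ℝ)) μK)) /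
          (∫ s, Real.exp (-β * ∑ i, |s i|)
            ∂(Measure.map (fun k : LinearMap.ker A.mulVecLin => s₀ + (k : Fin N → ℝ)) μK)))
        atTop (nhds 0) := by
  intro ε hε
  set V : Set (Fin N → ℝ) := {s | A.mulVecLin s = y} with hV
  have hV_closed : IsClosed V :=
    isClosed_eq (LinearMap.continuous_of_finiteDimensional _) continuous_const
  have hV_convex : Convex ℝ V := (convex_singleton y).linear_preimage A.mulVecLin
  have hl1 : ConvexOn ℝ V (fun s : Fin N → ℝ => ∑ i, |s i|) := by
    refine ⟨hV_convex, fun x _ z _ a b ha hb _ => ?_⟩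
    simp only [smul_eq_mul, Finset.mul_sum, ← Finset.sum_add_distrib]
    refine Finset.sum_le_sum fun i _ => (abs_add_le _ _).trans_eq ?_
    simp [abs_mul, abs_of_nonneg ha, abs_of_nonneg hb]
  obtain ⟨m, hm, hgap⟩ := hl1.exists_gap_of_unique_min (by fun_prop) hV_closed
    (x₀ := sstar) (by simpa [hV] using hstar)
    (fun s hs hne => huniq s (by simpa [hV] using hs) hne) hε
  have hmem : ∀ k : LinearMap.ker A.mulVecLin, s₀ + (k : Fin N → ℝ) ∈ V := fun k => by
    have hk : A.mulVecLin k = 0 := k.2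
    rw [hV, Set.mem_ofPred_eq, map_add, hk, add_zero, Matrix.mulVecLin_apply, hs₀]
  have hkstar : sstar - s₀ ∈ LinearMap.ker A.mulVecLin := by
    simp [Matrix.mulVec_sub, hs₀, hstar]
  have hemb : Topology.IsClosedEmbedding (fun k : LinearMap.ker A.mulVecLin => s₀ + (k : Fin N → ℝ)) :=
    (Homeomorph.addLeft s₀).isClosedEmbedding.comp
      (LinearMap.ker A.mulVecLin).closed_of_finiteDimensional.isClosedEmbedding_subtypeVal
  have hf : Continuous (fun k : LinearMap.ker A.mulVecLin => ∑ i, |(s₀ + (k : Fin N → ℝ)) i|) := by fun_prop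
  have hcoer : ∀ k : LinearMap.ker A.mulVecLin, ‖k‖ - ‖s₀‖ ≤ ∑ i, |(s₀ + (k : Fin N → ℝ)) i| := fun k => by
    have h1 : ‖s₀ + (k : Fin N → ℝ)‖ ≤ ∑ i, |(s₀ + (k : Fin N → ℝ)) i| :=
      (pi_norm_le_iff_of_nonneg (Finset.sum_nonneg fun i _ => abs_nonneg _)).2 fun i =>
        Finset.single_le_sum (f := fun i => |(s₀ + (k : Fin N → ℝ)) i|)
          (fun i _ => abs_nonneg _) (Finset.mem_univ i)
    have h2 : ‖(k : Fin N → ℝ)‖ ≤ ‖s₀ + (k : Fin N → ℝ)‖ + ‖s₀‖ := by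
      simpa using norm_sub_le (s₀ + (k : Fin N → ℝ)) s₀
    rw [← Submodule.coe_norm] at h2
    linarith
  have hint : Integrable (fun k : LinearMap.ker A.mulVecLin => Real.exp (-∑ i, |(s₀ + (k : Fin N → ℝ)) i|)) μK := by
    refine ((integrable_exp_neg_norm μK).const_mul (Real.exp ‖s₀‖)).mono'
      (by fun_prop) (ae_of_all _ fun k => ?_)
    rw [Real.norm_of_nonneg (Real.exp_pos _).le, ← Real.exp_add]
    exact Real.exp_le_exp.2 (by linarith [hcoer k])
  simp_rw [hemb.setIntegral_map, hemb.measurableEmbedding.integral_map]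
  refine tendsto_gibbs_ratio_zero μK hf hint (b := 0)
    (fun k => Finset.sum_nonneg fun i _ => abs_nonneg _) (x₀ := ⟨sstar - s₀, hkstar⟩) hm
    (hemb.continuous.measurable (measurableSet_lt measurable_const (by fun_prop)))
    fun k hk => ?_
  simpa using hgap _ (hmem k) hk
end
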